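/- arXiv:2605.00705 — 2 statements merged into one kernel-verified Lean document; each statement's English description precedes it below -/
import Mathlib

section
/- Let 0 ≤ r < n and let I be an admissible finite set of generators such that every vertex of Q_n occurs as an endpoint of some generator in I (i.e., the union of the generators in I is all of Q_n). Then I contains every antipodal generator, i.e., Θ_n ⊆ I. -/
/-- The integer in `{0, …, 2^n − 1}` corresponding to a vertex of `Q_n` via
binary expansion. -/
def val {n : ℕ} (a : Fin n → Bool) : ℕ := ∑ i, if a i then 2 ^ (i : ℕ) else 0

/-- A generator (for parameters `n, r`): an unordered pair `{a,b}` of distinct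
vertices of `Q_n` with `d_H(a,b) > r`, normalised so that `val fst < val snd`. -/
structure Gen (n r : ℕ) where
  fst : Fin n → Bool
  snd : Fin n → Bool
  hval : val fst < val snd
  hdist : r < hammingDist fst snd

/-- The order on generators: first by Hamming distance, then lexicographically
on the pair of integers (identifying vertices with integers via binary
expansion). -/
def genLT {n r : ℕ} (p q : Gen n r) : Prop :=
  hammingDist p.fst p.snd < hammingDist q.fst q.snd ∨
    (hammingDist p.fst p.snd = hammingDist q.fst q.snd ∧
      (val p.fst < val q.fst ∨ (p.fst = q.fst ∧ val p.snd < val q.snd)))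

/-- The two endpoints of a generator, viewed as a two-element subset of `Q_n`. -/
def ends {n r : ℕ} (p : Gen n r) : Set (Fin n → Bool) := {p.fst, p.snd}

/-- The union of the endpoints of all generators of `I` that are `≤ p`
(the initial segment of `I` determined by `p`). -/
def initUnion {n r : ℕ} (I : Set (Gen n r)) (p : Gen n r) : Set (Fin n → Bool) :=
  {x | ∃ p' ∈ I, (p' = p ∨ genLT p' p) ∧ x ∈ ends p'}

/-- A set `I` of generators is admissible if for every `p ∈ I` and every
generator `q > p`, the two-element set `q` is not contained in the union of the
generators of `I` that are `≤ p`. -/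
def admissible {n r : ℕ} (I : Set (Gen n r)) : Prop :=
  ∀ p ∈ I, ∀ q : Gen n r, genLT p q → ¬ (ends q ⊆ initUnion I p)

/-- `Θ_n`: the set of all antipodal generators `{a, ā}`, i.e. those of Hamming
distance `n`. -/
def Theta (n r : ℕ) : Set (Gen n r) := {p | hammingDist p.fst p.snd = n}

theorem val_injective {n : ℕ} : Function.Injective (val (n := n)) := by
  intro a b hab
  have key (c : Fin n → Bool) :
      val c = ∑ k ∈ (Finset.univ.filter fun i => c i = true).map Fin.valEmbedding, 2 ^ k := by
    simp [val, Finset.sum_filter]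
  rw [key, key] at hab
  have hs := Finset.map_injective _ (Finset.geomSum_injective le_rfl hab)
  funext i
  have hi := Finset.ext_iff.mp hs i
  simp only [Finset.mem_filter, Finset.mem_univ, true_and] at hi
  exact Bool.eq_iff_iff.mpr hi

theorem genLT_trichotomous {n r : ℕ} (p q : Gen n r) : p = q ∨ genLT p q ∨ genLT q p := by
  unfold genLT
  rcases lt_trichotomy (hammingDist p.fst p.snd) (hammingDist q.fst q.snd) with hd | hd | hd
  · tauto
  · rcases lt_trichotomy (val p.fst) (val q.fst) with hf | hf | hf
    · tauto
    · have hf' := val_injective hf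
      rcases lt_trichotomy (val p.snd) (val q.snd) with hs | hs | hs
      · tauto
      · left
        have hs' := val_injective hs
        cases p
        cases q
        simp_all
      · have := hf'.symm
        have := hd.symm
        tauto
    · have := hd.symm
      tauto
  · tauto

theorem eq_not_of_hammingDist_eq {n : ℕ} {a b : Fin n → Bool} (hab : hammingDist a b = n) :
    b = fun i => !a i := by
  have hfull : (Finset.univ.filter fun i => a i ≠ b i) = Finset.univ := by
    rw [← Finset.card_eq_iff_eq_univ]
    simpa [hammingDist] using hab
  funext i
  have hi : a i ≠ b i := by simpa using Finset.ext_iff.mp hfull i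
  cases ha : a i <;> cases hb : b i <;> simp_all

/-- Two antipodal generators that share an endpoint coincide. -/
theorem Theta.eq_of_mem_ends {n r : ℕ} {p q : Gen n r} (hp : p ∈ Theta n r)
    (hq : q ∈ Theta n r) {x : Fin n → Bool} (hxp : x ∈ ends p) (hxq : x ∈ ends q) : p = q := by
  obtain ⟨a, b, hab, _⟩ := p
  obtain ⟨c, d, hcd, _⟩ := q
  have hb := eq_not_of_hammingDist_eq hp
  have hd := eq_not_of_hammingDist_eq hq
  simp only [ends, Set.mem_insert_iff, Set.mem_singleton_iff] at hxp hxq hb hd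
  subst hb hd
  rcases hxp with rfl | rfl <;> rcases hxq with hx | hx
  · subst hx
    rfl
  · subst hx
    simp only [Bool.not_not] at hab
    exact absurd hab hcd.asymm
  · subst hx
    simp only [Bool.not_not] at hcd
    exact absurd hab hcd.asymm
  · have hac : a = c := by
      funext i
      simpa using congrFun hx i
    subst hac
    rfl

/-- A generator other than the antipodal generator `q` that shares an endpoint with it
precedes it. -/
theorem genLT_of_mem_ends_of_mem_Theta {n r : ℕ} {p q : Gen n r} (hq : q ∈ Theta n r)
    (hpq : p ≠ q) {x : Fin n → Bool} (hxp : x ∈ ends p) (hxq : x ∈ ends q) : genLT p q := by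
  have hle : hammingDist p.fst p.snd ≤ n := by
    simpa using hammingDist_le_card_fintype (x := p.fst) (y := p.snd)
  have hne : hammingDist p.fst p.snd ≠ n := fun hp => hpq (Theta.eq_of_mem_ends hp hq hxp hxq)
  exact Or.inl ((lt_of_le_of_ne hle hne).trans_eq (Eq.symm hq))

/-- If `0 ≤ r < n` and `I` is an admissible finite set of generators whose
endpoints cover all of `Q_n`, then `I` contains every antipodal generator:
`Θ_n ⊆ I`. -/
theorem theta_subset_of_admissible_cover (n r : ℕ) (h : r < n)
    (I : Set (Gen n r)) (hfin : I.Finite) (hadm : admissible I)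
    (hcov : ∀ x : Fin n → Bool, ∃ p ∈ I, x ∈ ends p) :
    Theta n r ⊆ I := by
  intro q hq
  by_contra hqI
  obtain ⟨p₁, hp₁, hx₁⟩ := hcov q.fst
  obtain ⟨p₂, hp₂, hx₂⟩ := hcov q.snd
  have hlt₁ : genLT p₁ q :=
    genLT_of_mem_ends_of_mem_Theta hq (fun e => hqI (e ▸ hp₁)) hx₁ (Or.inl rfl)
  have hlt₂ : genLT p₂ q :=
    genLT_of_mem_ends_of_mem_Theta hq (fun e => hqI (e ▸ hp₂)) hx₂ (Or.inr rfl)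
  have hcases : (p₁ = p₂ ∨ genLT p₁ p₂) ∨ genLT p₂ p₁ := by
    rw [or_assoc]
    exact genLT_trichotomous p₁ p₂
  rcases hcases with h₁₂ | h₂₁
  · refine hadm p₂ hp₂ q hlt₂ ?_
    rintro x (rfl | rfl)
    · exact ⟨p₁, hp₁, h₁₂, hx₁⟩
    · exact ⟨p₂, hp₂, Or.inl rfl, hx₂⟩
  · refine hadm p₁ hp₁ q hlt₁ ?_
    rintro x (rfl | rfl)
    · exact ⟨p₁, hp₁, Or.inl rfl, hx₁⟩
    · exact ⟨p₂, hp₂, Or.inr h₂₁, hx₂⟩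
end

section
/- Let v ∈ Q_5, fix i ∈ {1,…,5}, and for each j ∈ {1,…,5} \ {i} let {k,l,m} = {1,…,5} \ {i,j}. Consider the five pairs P_0 = {v, v^{12345}} and P_j = {v^{ij}, v^{klm}} for the four values of j. Then the ten vertices are pairwise distinct, the two vertices of each pair are at Hamming distance 5, and any two vertices lying in different pairs are at Hamming distance at most 3. Consequently, every subset of these ten vertices containing no complete pair has Hamming diameter at most 3, so the join of these five pairs (the boundary of a 5-dimensional cross polytope) is a subcomplex of VR(Q_5;3). -/
/-- `flipSet v T` is the vertex `v^T` of `Q_5` obtained from `v` by flipping the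
coordinates in `T`. -/
def flipSet (v : Fin 5 → Bool) (T : Finset (Fin 5)) : Fin 5 → Bool :=
  fun x => if x ∈ T then !(v x) else v x

open scoped symmDiff

theorem flipSet_empty (v : Fin 5 → Bool) : flipSet v ∅ = v := by
  funext x
  simp [flipSet]

/-- The Hamming distance between two flips of `v` is the number of coordinates flipped in exactly
one of them. -/
theorem hammingDist_flipSet (v : Fin 5 → Bool) (S T : Finset (Fin 5)) :
    hammingDist (flipSet v S) (flipSet v T) = (S ∆ T).card := by
  unfold hammingDist
  congr 1
  ext x
  rw [Finset.mem_filter, Finset.mem_symmDiff]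
  by_cases hS : x ∈ S <;> by_cases hT : x ∈ T <;>
    simp [flipSet, hS, hT]

/-- The set of coordinates flipped in the first vertex of the pair indexed by `t`. -/
def pairSupport (i t : Fin 5) : Finset (Fin 5) := if t = i then ∅ else {i, t}

theorem card_symmDiff_pairSupport_le (i t s : Fin 5) (h : t ≠ s) :
    (pairSupport i t ∆ pairSupport i s).card ≤ 3 ∧
    (pairSupport i t ∆ (pairSupport i s)ᶜ).card ≤ 3 ∧
    ((pairSupport i t)ᶜ ∆ pairSupport i s).card ≤ 3 ∧
    ((pairSupport i t)ᶜ ∆ (pairSupport i s)ᶜ).card ≤ 3 := by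
  revert i t s
  decide

/-- Family (B): for `v ∈ Q_5` and a fixed `i`, the five pairs
`P_0 = {v, v^{12345}}` and `P_j = {v^{ij}, v^{klm}}` (for the four `j ≠ i`,
where `{k,l,m} = {1,…,5} \ {i,j}`, so `v^{klm} = v^{({i,j})ᶜ}`) consist of
ten pairwise distinct vertices, each pair at Hamming distance 5, while
vertices in different pairs are at Hamming distance at most 3.  Consequently
every subset of the ten vertices containing no complete pair has Hamming
diameter at most 3, so the join of these five pairs (the boundary of a
5-dimensional cross polytope) is a subcomplex of `VR(Q_5;3)`.
Here the pair `P_0` is indexed by `i` itself. -/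
theorem crossPolytope_family_B (v : Fin 5 → Bool) (i : Fin 5)
    (P : Fin 5 → ((Fin 5 → Bool) × (Fin 5 → Bool)))
    (hPi : P i = (v, flipSet v Finset.univ))
    (hPj : ∀ j : Fin 5, j ≠ i →
      P j = (flipSet v {i, j}, flipSet v (({i, j} : Finset (Fin 5))ᶜ))) :
    (Function.Injective
      (fun x : Fin 5 × Bool => if x.2 then (P x.1).1 else (P x.1).2)) ∧
    (∀ t : Fin 5, hammingDist (P t).1 (P t).2 = 5) ∧
    (∀ t s : Fin 5, t ≠ s → ∀ x y : Fin 5 → Bool,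
      (x = (P t).1 ∨ x = (P t).2) → (y = (P s).1 ∨ y = (P s).2) →
      hammingDist x y ≤ 3) ∧
    (∀ σ : Finset (Fin 5 → Bool),
      (∀ x ∈ σ, ∃ t : Fin 5, x = (P t).1 ∨ x = (P t).2) →
      (∀ t : Fin 5, ¬ ((P t).1 ∈ σ ∧ (P t).2 ∈ σ)) →
      ∀ x ∈ σ, ∀ y ∈ σ, hammingDist x y ≤ 3) := by
  have hP (t : Fin 5) :
      P t = (flipSet v (pairSupport i t), flipSet v (pairSupport i t)ᶜ) := by
    by_cases h : t = i
    · subst h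
      simp [hPi, pairSupport, flipSet_empty]
    · simp [hPj t h, pairSupport, h]
  have antipodal (t : Fin 5) : hammingDist (P t).1 (P t).2 = 5 := by
    simp [hP, hammingDist_flipSet]
  have near (t s : Fin 5) (hts : t ≠ s) (x y : Fin 5 → Bool)
      (hx : x = (P t).1 ∨ x = (P t).2) (hy : y = (P s).1 ∨ y = (P s).2) :
      hammingDist x y ≤ 3 := by
    obtain ⟨h₁, h₂, h₃, h₄⟩ := card_symmDiff_pairSupport_le i t s hts
    rw [hP] at hx hy
    rcases hx with rfl | rfl <;> rcases hy with rfl | rfl <;>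
      simpa only [hammingDist_flipSet]
  have ne (t : Fin 5) : (P t).1 ≠ (P t).2 := fun h => by
    simpa [h] using antipodal t
  refine ⟨?_, antipodal, near, ?_⟩
  · rintro ⟨t, a⟩ ⟨s, b⟩ hab
    obtain rfl | hts := eq_or_ne t s
    · cases a <;> cases b <;> simp [ne t, (ne t).symm] at hab ⊢
    · -- A common vertex would be within distance 3 of its own antipode.
      have h₁ := near t s hts (P t).1 (if b then (P s).1 else (P s).2) (.inl rfl)
        (by cases b <;> simp)
      have h₂ := near t s hts (P t).2 (if b then (P s).1 else (P s).2) (.inr rfl)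
        (by cases b <;> simp)
      have h := antipodal t
      simp only at hab
      rw [← hab] at h₁ h₂
      rw [hammingDist_comm] at h₂
      cases a <;> simp only [Bool.false_eq_true, if_true, if_false] at h₁ h₂ <;> omega
  · intro σ hσ hfree x hx y hy
    obtain ⟨t, ht⟩ := hσ x hx
    obtain ⟨s, hs⟩ := hσ y hy
    obtain rfl | hts := eq_or_ne t s
    · have := hfree t
      rcases ht with rfl | rfl <;> rcases hs with rfl | rfl <;> simp_all
    · exact near t s hts x y ht hs
end
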